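/- Let x, y, z be complex numbers with |x| < 1/2, |y| < 1/4, x ≠ 0, y ≠ 0 and |z²| < |xy|. Then for all complex t with 0 < |t| < 1/2, t(1−t²) Φ₀″(t) + ( (1−x)(1−t²) − 2ty ) Φ₀′(t) + 2(xy − z²) Φ₀(t) = 2. -/

import Mathlib

open Complex Filter Metric Finset

attribute [local instance] Classical.propDecidable

noncomputable section

/-- Condition on the summation variables of the level-two multiple polylogarithm:
`m` is strictly increasing, `m i ≡ i+1 (mod 2)` (so `m 0` is odd, `m 1` even, ...),
and all `m i` are positive. -/
def athCond (n : ℕ) (m : Fin n → ℕ) : Prop :=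
  StrictMono m ∧ ∀ i : Fin n, m i % 2 = ((i : ℕ) + 1) % 2 ∧ 0 < m i

/-- The last entry `m n` of the summation sequence (junk value `0` for depth `0`). -/
def lastExp {n : ℕ} (m : Fin n → ℕ) : ℕ :=
  if h : 0 < n then m ⟨n - 1, Nat.sub_lt h Nat.one_pos⟩ else 0

/-- The level-two multiple polylogarithm
`Ath(𝐤; t) = Σ_{0<m₁<⋯<mₙ, mᵢ ≡ i (2)} t^{mₙ}/(m₁^{k₁}⋯mₙ^{kₙ})`, with `Ath(∅;t) = 1`. -/
def Ath {n : ℕ} (k : Fin n → ℕ) (t : ℂ) : ℂ :=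
  ∑' m : Fin n → ℕ,
    if athCond n m then t ^ lastExp m / ∏ i, ((m i : ℂ) ^ k i) else 0

/-- The multiple T-value `T(𝐤) = 2^n Σ_{0<m₁<⋯<mₙ, mᵢ ≡ i (2)} 1/(m₁^{k₁}⋯mₙ^{kₙ})`. -/
def Tval {n : ℕ} (k : Fin n → ℕ) : ℝ :=
  2 ^ n * ∑' m : Fin n → ℕ,
    if athCond n m then (∏ i, ((m i : ℝ) ^ k i))⁻¹ else 0

/-- `κ` is an index of weight `k`, depth `n` and height `s`. -/
def IdxCond (k n s : ℕ) (κ : Fin n → ℕ) : Prop :=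
  (∀ i, 1 ≤ κ i) ∧ (∑ i, κ i) = k ∧ (Finset.univ.filter fun i => 2 ≤ κ i).card = s

/-- `κ` is an admissible index of weight `k`, depth `n` and height `s`. -/
def IdxCond0 (k n s : ℕ) (κ : Fin n → ℕ) : Prop :=
  IdxCond k n s κ ∧ ∀ h : 0 < n, 2 ≤ κ ⟨n - 1, Nat.sub_lt h Nat.one_pos⟩

/-- `G(k,n,s;t) = 2^n Σ_{𝐤 ∈ I(k,n,s)} Ath(𝐤;t)`. -/
def G (k n s : ℕ) (t : ℂ) : ℂ :=
  2 ^ n * ∑' κ : Fin n → ℕ, if IdxCond k n s κ then Ath κ t else 0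

/-- `G₀(k,n,s;t) = 2^n Σ_{𝐤 ∈ I₀(k,n,s)} Ath(𝐤;t)`. -/
def G0 (k n s : ℕ) (t : ℂ) : ℂ :=
  2 ^ n * ∑' κ : Fin n → ℕ, if IdxCond0 k n s κ then Ath κ t else 0

/-- `Σ_{𝐤 ∈ I₀(k,n,s)} T(𝐤)`. -/
def sumT0 (k n s : ℕ) : ℝ :=
  ∑' κ : Fin n → ℕ, if IdxCond0 k n s κ then Tval κ else 0

/-- One term of the generating function `Φ`. -/
def PhiTerm (x y z : ℂ) (p : ℕ × ℕ × ℕ) (t : ℂ) : ℂ :=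
  if 1 ≤ p.1 ∧ 1 ≤ p.2.1 then
    G p.1 p.2.1 p.2.2 t * x ^ (p.1 - p.2.1 - p.2.2) * y ^ (p.2.1 - p.2.2) * z ^ (2 * p.2.2)
  else 0

/-- `Φ(x,y,z;t) = 1 + Σ_{k,n≥1, s≥0} G(k,n,s;t) x^{k−n−s} y^{n−s} z^{2s}`. -/
def Phi (x y z t : ℂ) : ℂ := 1 + ∑' p : ℕ × ℕ × ℕ, PhiTerm x y z p t

/-- One term of the generating function `Φ₀`. -/
def Phi0Term (x y z : ℂ) (p : ℕ × ℕ × ℕ) (t : ℂ) : ℂ :=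
  if 1 ≤ p.1 ∧ 1 ≤ p.2.1 ∧ 1 ≤ p.2.2 then
    G0 p.1 p.2.1 p.2.2 t * x ^ (p.1 - p.2.1 - p.2.2) * y ^ (p.2.1 - p.2.2)
      * z ^ (2 * (p.2.2 - 1))
  else 0

/-- `Φ₀(x,y,z;t) = Σ_{k,n,s≥1} G₀(k,n,s;t) x^{k−n−s} y^{n−s} z^{2(s−1)}`. -/
def Phi0 (x y z t : ℂ) : ℂ := ∑' p : ℕ × ℕ × ℕ, Phi0Term x y z p t

/-- The shifted factorial `(a)ₙ = a(a+1)⋯(a+n−1)`. -/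
def poch (a : ℂ) (n : ℕ) : ℂ := ∏ j ∈ Finset.range n, (a + j)

/-- The Gauss hypergeometric series `F(a,b,c;t)`. -/
def hypF (a b c t : ℂ) : ℂ :=
  ∑' n : ℕ, poch a n * poch b n / ((n.factorial : ℂ) * poch c n) * t ^ n

def vv {K : Type*} [RCLike K] (x y Z : K) : ℕ → K
  | 0 => 0
  | 1 => y
  | (k + 2) => x ^ k * Z

def uu {K : Type*} [RCLike K] (x y Z : K) (k m : ℕ) : K := 2 * vv x y Z k / (m : K) ^ k

def ww {K : Type*} [RCLike K] (x y Z : K) (m : ℕ) : K :=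
  2 * (y / (m : K) + Z / ((m : K) * ((m : K) - x)))

def Sn {K : Type*} [RCLike K] (w : ℕ → K) : ℕ → ℕ → K
  | 0, N => if N % 2 = 1 then 1 else 0
  | (n + 1), N => if N % 2 = (n + 2) % 2 then ∑ M ∈ Finset.range N, w M * Sn w n M else 0

def PP {K : Type*} [RCLike K] (x y Z : K) (n : ℕ) (κ m : Fin n → ℕ) (N : ℕ) : K :=
  if athCond (n + 1) (Fin.snoc m N : Fin (n + 1) → ℕ) then ∏ i, uu x y Z (κ i) (m i) else 0

lemma norm_uu (x y Z : ℂ) (k m : ℕ) : ‖uu x y Z k m‖ = uu ‖x‖ ‖y‖ ‖Z‖ k m := by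
  rcases k with _ | _ | k <;> simp [uu, vv]

lemma norm_PP (x y Z : ℂ) (n : ℕ) (κ m : Fin n → ℕ) (N : ℕ) :
    ‖PP x y Z n κ m N‖ = PP ‖x‖ ‖y‖ ‖Z‖ n κ m N := by
  unfold PP
  split_ifs <;> simp [norm_prod, norm_uu]

lemma hasSum_uu {K : Type*} [RCLike K] (x y Z : K) (hx : ‖x‖ < 1) (m : ℕ) (hm : 1 ≤ m) :
    HasSum (fun k => uu x y Z k m) (ww x y Z m) := by
  have hm' : (m : K) ≠ 0 := by
    have : m ≠ 0 := by omega
    exact_mod_cast this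
  have hm1 : (1 : ℝ) ≤ m := by exact_mod_cast hm
  have hq : ‖x / m‖ < 1 := by
    rw [norm_div, RCLike.norm_natCast, div_lt_one (by linarith)]
    linarith
  have hmx : (m : K) - x ≠ 0 := by
    intro h
    have : (m : K) = x := sub_eq_zero.mp h
    rw [← this, RCLike.norm_natCast] at hx
    linarith
  rw [← hasSum_nat_add_iff' 2]
  have h := (hasSum_geometric_of_norm_lt_one hq).mul_left (2 * Z / (m : K) ^ 2)
  have e1 : (fun k => uu x y Z (k + 2) m) = fun k => 2 * Z / (m : K) ^ 2 * (x / (m : K)) ^ k := by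
    ext k
    simp only [uu, vv]
    rw [div_pow, pow_add]
    field_simp
  have e2 : ww x y Z m - ∑ i ∈ Finset.range 2, uu x y Z i m
      = 2 * Z / (m : K) ^ 2 * (1 - x / (m : K))⁻¹ := by
    have e3 : 1 - x / (m : K) = ((m : K) - x) / m := by field_simp
    rw [e3, inv_div]
    simp only [Finset.sum_range_succ, Finset.sum_range_zero, uu, vv, ww]
    field_simp
    ring
  rw [e1, e2]
  exact h

lemma summable_norm_uu {K : Type*} [RCLike K] (x y Z : K) (hx : ‖x‖ < 1) (m : ℕ) (hm : 1 ≤ m) :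
    Summable (fun k => ‖uu x y Z k m‖) :=
  (hasSum_uu x y Z hx m hm).summable.norm

lemma athCond_snoc (n : ℕ) (m : Fin n → ℕ) (N : ℕ) :
    athCond (n + 1) (Fin.snoc m N : Fin (n + 1) → ℕ) ↔
      athCond n m ∧ (∀ i, m i < N) ∧ N % 2 = (n + 1) % 2 ∧ 0 < N := by
  unfold athCond
  constructor
  · rintro ⟨h1, h2⟩
    refine ⟨⟨?_, ?_⟩, ?_, ?_⟩
    · intro i j hij
      have := h1 (Fin.castSucc_lt_castSucc_iff.mpr hij)
      simpa using this
    · intro i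
      simpa using h2 i.castSucc
    · intro i
      have := h1 (Fin.castSucc_lt_last i)
      simpa using this
    · simpa using h2 (Fin.last n)
  · rintro ⟨⟨h1, h2⟩, h3, h4⟩
    refine ⟨?_, ?_⟩
    · intro i j hij
      induction j using Fin.lastCases with
      | last =>
        induction i using Fin.lastCases with
        | last => exact absurd hij (lt_irrefl _)
        | cast i => simpa using h3 i
      | cast j =>
        induction i using Fin.lastCases with
        | last => exact absurd hij (not_lt.mpr (Fin.le_last _))
        | cast i => simpa using h1 (Fin.castSucc_lt_castSucc_iff.mp hij)
    · intro i
      induction i using Fin.lastCases with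
      | last => simpa using h4
      | cast i => simpa using h2 i

lemma athCond_snoc2 (n : ℕ) (m : Fin n → ℕ) (M N : ℕ) :
    athCond (n + 2) (Fin.snoc (Fin.snoc m M : Fin (n + 1) → ℕ) N : Fin (n + 2) → ℕ) ↔
      athCond (n + 1) (Fin.snoc m M : Fin (n + 1) → ℕ) ∧ M < N ∧ N % 2 = (n + 2) % 2 := by
  rw [athCond_snoc (n + 1)]
  constructor
  · rintro ⟨h1, h2, h3⟩
    refine ⟨h1, by simpa using h2 (Fin.last n), h3.1⟩
  · rintro ⟨h1, h2, h3⟩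
    refine ⟨h1, ?_, h3, by omega⟩
    intro i
    have : (Fin.snoc m M : Fin (n + 1) → ℕ) i ≤ (Fin.snoc m M : Fin (n + 1) → ℕ) (Fin.last n) :=
      h1.1.monotone (Fin.le_last i)
    rw [Fin.snoc_last] at this
    omega

lemma hasSum_fin_prod {K B : Type*} [RCLike K] (f : ℕ × B → K) (a : ℕ → K) (N : ℕ)
    (h0 : ∀ M b, N ≤ M → f (M, b) = 0) (h : ∀ M, M < N → HasSum (fun b => f (M, b)) (a M)) :
    HasSum f (∑ M ∈ Finset.range N, a M) := by
  have key : ∀ M ∈ Finset.range N,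
      HasSum (fun q : ℕ × B => if q.1 = M then f q else 0) (a M) := by
    intro M hM
    have hinj : Function.Injective (fun b : B => (M, b)) := fun b c hbc => (Prod.mk.inj hbc).2
    rw [← hinj.hasSum_iff]
    · simpa [Function.comp_def] using h M (Finset.mem_range.mp hM)
    · rintro ⟨M', b⟩ hb
      have : M' ≠ M := by
        rintro rfl
        exact hb ⟨b, rfl⟩
      simp [this]
  have := hasSum_sum key
  convert this using 1
  ext ⟨M, b⟩
  simp only [Finset.sum_ite_eq, Finset.mem_range]
  split_ifs with hM
  · rfl
  · exact h0 M b (by omega)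

lemma hasSum_mul' {K A B : Type*} [RCLike K] {f : A → K} {g : B → K} {s t : K}
    (hf : HasSum f s) (hg : HasSum g t) : HasSum (fun q : A × B => f q.1 * g q.2) (s * t) :=
  hf.mul hg (summable_mul_of_summable_norm hf.summable.norm hg.summable.norm)

def stepEquiv (n : ℕ) : ((Fin (n + 1) → ℕ) × (Fin (n + 1) → ℕ)) ≃
    (ℕ × (((Fin n → ℕ) × (Fin n → ℕ)) × ℕ)) where
  toFun b := (b.2 (Fin.last n), ((Fin.init b.1, Fin.init b.2), b.1 (Fin.last n)))
  invFun q := (Fin.snoc q.2.1.1 q.2.2, Fin.snoc q.2.1.2 q.1)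
  left_inv b := by simp
  right_inv q := by simp

lemma hasSum_PP {K : Type*} [RCLike K] (x y Z : K) (hx : ‖x‖ < 1) (n N : ℕ) :
    HasSum (fun b : (Fin n → ℕ) × (Fin n → ℕ) => PP x y Z n b.1 b.2 N)
      (Sn (ww x y Z) n N) := by
  induction n generalizing N with
  | zero =>
    have hd : ∀ m : Fin 0 → ℕ, athCond 0 m := fun m => ⟨fun i => i.elim0, fun i => i.elim0⟩
    have e : (fun b : (Fin 0 → ℕ) × (Fin 0 → ℕ) => PP x y Z 0 b.1 b.2 N) =
        fun _ => Sn (ww x y Z) 0 N := by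
      ext b
      simp only [PP, Sn, athCond_snoc]
      by_cases h : N % 2 = 1
      · have : 0 < N := by omega
        simp [h, this, hd]
      · simp [h]
    rw [e]
    have : Unique ((Fin 0 → ℕ) × (Fin 0 → ℕ)) := Unique.mk' _
    exact hasSum_unique (fun _ : (Fin 0 → ℕ) × (Fin 0 → ℕ) => Sn (ww x y Z) 0 N)
  | succ n ih =>
    rw [← (stepEquiv n).symm.hasSum_iff]
    have hval : ∀ q : ℕ × (((Fin n → ℕ) × (Fin n → ℕ)) × ℕ),
        ((fun b : (Fin (n + 1) → ℕ) × (Fin (n + 1) → ℕ) => PP x y Z (n + 1) b.1 b.2 N) ∘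
          (stepEquiv n).symm) q = if N % 2 = (n + 2) % 2 ∧ q.1 < N then
            PP x y Z n q.2.1.1 q.2.1.2 q.1 * uu x y Z q.2.2 q.1 else 0 := by
      rintro ⟨M, ⟨κ, m⟩, k⟩
      simp only [Function.comp, stepEquiv, Equiv.coe_fn_symm_mk, PP, athCond_snoc2]
      rw [Fin.prod_univ_castSucc]
      simp only [Fin.snoc_castSucc, Fin.snoc_last]
      split_ifs <;> first | rfl | (exfalso; tauto) | simp
    rw [funext hval]
    simp only [Sn]
    by_cases hp : N % 2 = (n + 2) % 2
    · rw [if_pos hp]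
      refine hasSum_fin_prod _ (fun M => ww x y Z M * Sn (ww x y Z) n M) N ?_ ?_
      · intro M b hM
        rw [if_neg]
        simp; omega
      · intro M hM
        simp only [hp, hM, and_self, if_true]
        rcases Nat.eq_zero_or_pos M with rfl | hM0
        · have h0 : ∀ κ m, PP x y Z n κ m 0 = 0 := by
            intro κ m
            simp [PP, athCond_snoc]
          have h1 : Sn (ww x y Z) n 0 = 0 := by cases n <;> simp [Sn]
          simp only [h0, h1, zero_mul, mul_zero]
          exact hasSum_zero
        · rw [mul_comm]
          exact hasSum_mul' (f := fun b : (Fin n → ℕ) × (Fin n → ℕ) => PP x y Z n b.1 b.2 M)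
            (g := fun k => uu x y Z k M) (ih M) (hasSum_uu x y Z hx M hM0)
    · rw [if_neg hp]
      simp only [hp, false_and, if_false]
      exact hasSum_zero

lemma Sn_zero {K : Type*} [RCLike K] (w : ℕ → K) (n : ℕ) : Sn w n 0 = 0 := by
  cases n <;> simp [Sn]

lemma Sn_parity {K : Type*} [RCLike K] (w : ℕ → K) (n N : ℕ) (h : N % 2 ≠ (n + 1) % 2) :
    Sn w n N = 0 := by
  cases n with
  | zero => simp only [Sn]; rw [if_neg (by simpa using h)]
  | succ n => simp only [Sn]; rw [if_neg h]

lemma Sn_rec {K : Type*} [RCLike K] (w : ℕ → K) (n N : ℕ) :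
    Sn w (n + 1) (N + 2) = Sn w (n + 1) N + w (N + 1) * Sn w n (N + 1) := by
  by_cases h : N % 2 = (n + 2) % 2
  · have h2 : (N + 2) % 2 = (n + 2) % 2 := by omega
    simp only [Sn]
    rw [if_pos h, if_pos h2, Finset.sum_range_succ, Finset.sum_range_succ,
      Sn_parity w n N (by omega)]
    ring
  · rw [Sn_parity w (n + 1) (N + 2) (by omega), Sn_parity w (n + 1) N (by omega),
      Sn_parity w n (N + 1) (by omega)]
    simp

lemma Sn_rec0 {K : Type*} [RCLike K] (w : ℕ → K) (N : ℕ) :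
    Sn w 0 (N + 2) = Sn w 0 N := by
  simp [Sn]

lemma Sn_small {K : Type*} [RCLike K] (w : ℕ → K) (n N : ℕ) (h : N ≤ n) : Sn w n N = 0 := by
  induction n generalizing N with
  | zero => obtain rfl : N = 0 := by omega
            exact Sn_zero w 0
  | succ n ih =>
    simp only [Sn]
    rw [Finset.sum_eq_zero]
    · simp
    · intro M hM
      rw [ih M (by have := Finset.mem_range.mp hM; omega), mul_zero]

def SS {K : Type*} [RCLike K] (w : ℕ → K) (N : ℕ) : K := ∑ n ∈ Finset.range N, Sn w n N

lemma SS_eq {K : Type*} [RCLike K] (w : ℕ → K) (N R : ℕ) (h : N ≤ R) :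
    ∑ n ∈ Finset.range R, Sn w n N = SS w N := by
  unfold SS
  symm
  apply Finset.sum_subset
  · intro i hi
    simp at *; omega
  · intro i _ hi
    apply Sn_small
    simpa using hi

lemma SS_rec {K : Type*} [RCLike K] (w : ℕ → K) (N : ℕ) :
    SS w (N + 2) = SS w N + w (N + 1) * SS w (N + 1) := by
  rw [← SS_eq w (N + 2) (N + 2) le_rfl, ← SS_eq w N (N + 2) (by omega)]
  rw [Finset.sum_range_succ', Finset.sum_range_succ' _ (N + 1)]
  simp only [Sn_rec, Sn_rec0, Finset.sum_add_distrib, ← Finset.mul_sum]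
  rw [SS_eq w (N + 1) (N + 1) le_rfl]
  ring

lemma SS_zero {K : Type*} [RCLike K] (w : ℕ → K) : SS w 0 = 0 := by simp [SS]
lemma SS_one {K : Type*} [RCLike K] (w : ℕ → K) : SS w 1 = 1 := by simp [SS, Sn]

lemma hasSum_Sn {K : Type*} [RCLike K] (w : ℕ → K) (N : ℕ) :
    HasSum (fun n => Sn w n N) (SS w N) := by
  apply hasSum_sum_of_ne_finset_zero
  intro n hn
  exact Sn_small w n N (by simpa using hn)

lemma SS_bound {K : Type*} [RCLike K] (w : ℕ → K) (hw : ∀ m, 1 ≤ m → ‖w m‖ ≤ 1) (N : ℕ) :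
    ‖SS w N‖ ≤ 2 ^ N ∧ ‖SS w (N + 1)‖ ≤ 2 ^ (N + 1) := by
  induction N with
  | zero => simp [SS_zero, SS_one]
  | succ N ih =>
    refine ⟨ih.2, ?_⟩
    rw [SS_rec]
    calc _ ≤ ‖SS w N‖ + ‖w (N + 1)‖ * ‖SS w (N + 1)‖ := by
            rw [← norm_mul]; exact norm_add_le _ _
      _ ≤ 2 ^ N + 1 * 2 ^ (N + 1) := by
            gcongr
            · exact ih.1
            · exact hw _ (by omega)
            · exact ih.2
      _ ≤ _ := by
            have : (0 : ℝ) < 2 ^ N := by positivity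
            rw [pow_succ, pow_succ, pow_succ]; linarith

lemma ww_bound {K : Type*} [RCLike K] (x y Z : K) (a b : ℝ) (hx : ‖x‖ ≤ 1 / 2)
    (hy : ‖y‖ ≤ a) (hZ : ‖Z‖ ≤ b) (m : ℕ) : ‖ww x y Z m‖ ≤ 2 * (a + 2 * b) := by
  have ha : 0 ≤ a := (norm_nonneg _).trans hy
  have hb : 0 ≤ b := (norm_nonneg _).trans hZ
  rcases Nat.eq_zero_or_pos m with rfl | hm
  · simp [ww]; positivity
  · have hm1 : (1 : ℝ) ≤ m := by exact_mod_cast hm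
    have h1 : 1 / 2 ≤ ‖(m : K) - x‖ := by
      have := norm_sub_norm_le (m : K) x
      rw [RCLike.norm_natCast] at this
      linarith
    have h2 : ‖y / (m : K)‖ ≤ a := by
      rw [norm_div, RCLike.norm_natCast]
      rw [div_le_iff₀ (by linarith)]
      nlinarith
    have h3 : ‖Z / ((m : K) * ((m : K) - x))‖ ≤ 2 * b := by
      rw [norm_div, norm_mul, RCLike.norm_natCast]
      have h4 : 1 / 2 ≤ (m : ℝ) * ‖(m : K) - x‖ := by nlinarith
      rw [div_le_iff₀ (by linarith)]
      nlinarith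
    unfold ww
    rw [norm_mul, RCLike.norm_ofNat]
    have := norm_add_le (y / (m : K)) (Z / ((m : K) * ((m : K) - x)))
    linarith

def FF {K : Type*} [RCLike K] (x y Z t : K)
    (j : Σ q : ℕ × ℕ, ((Fin q.1 → ℕ) × (Fin q.1 → ℕ)) × ℕ) : K :=
  PP x y Z j.1.1 j.2.1.1 j.2.1.2 j.1.2 * (uu x 0 1 j.2.2 j.1.2 * t ^ j.1.2)

lemma norm_FF (x y Z t : ℂ) (j : Σ q : ℕ × ℕ, ((Fin q.1 → ℕ) × (Fin q.1 → ℕ)) × ℕ) :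
    ‖FF x y Z t j‖ = FF ‖x‖ ‖y‖ ‖Z‖ ‖t‖ j := by
  simp [FF, norm_PP, norm_uu]

lemma hasSum_FF_fiber {K : Type*} [RCLike K] (x y Z t : K) (hx : ‖x‖ < 1) (q : ℕ × ℕ) :
    HasSum (fun b => FF x y Z t ⟨q, b⟩) (Sn (ww x y Z) q.1 q.2 * (ww x 0 1 q.2 * t ^ q.2)) := by
  obtain ⟨n, N⟩ := q
  simp only [FF]
  rcases Nat.eq_zero_or_pos N with rfl | hM0
  · have h0 : ∀ κ m, PP x y Z n κ m 0 = 0 := by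
      intro κ m
      simp [PP, athCond_snoc]
    simp only [h0, Sn_zero, zero_mul]
    exact hasSum_zero
  · exact hasSum_mul' (f := fun b : (Fin n → ℕ) × (Fin n → ℕ) => PP x y Z n b.1 b.2 N)
      (g := fun k => uu x 0 1 k N * t ^ N) (hasSum_PP x y Z hx n N)
      ((hasSum_uu x 0 1 hx N hM0).mul_right _)

lemma summable_outer (x y Z t : ℝ) (hx : ‖x‖ < 1 / 2) (hy : ‖y‖ < 1 / 4) (hZ : ‖Z‖ < 1 / 8)
    (ht : ‖t‖ < 1 / 2) :
    Summable (fun N => SS (ww x y Z) N * (ww x 0 1 N * t ^ N)) := by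
  have hg : Summable (fun N : ℕ => 4 * (2 * ‖t‖) ^ N) :=
    (summable_geometric_of_lt_one (by positivity) (by linarith)).mul_left 4
  refine Summable.of_norm_bounded hg fun N => ?_
  rw [norm_mul, norm_mul, norm_pow, mul_pow]
  have b1 := (SS_bound (ww x y Z) (fun m _ => by
    have := ww_bound x y Z (1/4) (1/8) hx.le hy.le hZ.le m
    linarith) N).1
  have b2 : ‖ww x 0 1 N‖ ≤ 4 := by
    have := ww_bound x 0 1 0 1 hx.le (by simp) (by simp) N
    linarith
  calc _ ≤ (2 : ℝ) ^ N * (4 * ‖t‖ ^ N) := by gcongr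
    _ = _ := by ring

lemma summable_mid (x y Z t : ℝ) (hx : ‖x‖ < 1 / 2) (hy : ‖y‖ < 1 / 4) (hZ : ‖Z‖ < 1 / 8)
    (ht : ‖t‖ < 1 / 2)
    (hpos : ∀ q : ℕ × ℕ, 0 ≤ Sn (ww x y Z) q.1 q.2 * (ww x 0 1 q.2 * t ^ q.2)) :
    Summable (fun q : ℕ × ℕ => Sn (ww x y Z) q.1 q.2 * (ww x 0 1 q.2 * t ^ q.2)) := by
  have hin : ∀ N : ℕ, HasSum (fun n => Sn (ww x y Z) n N * (ww x 0 1 N * t ^ N))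
      (SS (ww x y Z) N * (ww x 0 1 N * t ^ N)) :=
    fun N => HasSum.mul_right (ww x 0 1 N * t ^ N) (hasSum_Sn (ww x y Z) N)
  have h : Summable (fun q : ℕ × ℕ => Sn (ww x y Z) q.2 q.1 * (ww x 0 1 q.1 * t ^ q.1)) := by
    have hp : 0 ≤ (fun q : ℕ × ℕ => Sn (ww x y Z) q.2 q.1 * (ww x 0 1 q.1 * t ^ q.1)) :=
      fun q => hpos (q.2, q.1)
    refine (summable_prod_of_nonneg hp).mpr ⟨fun N => (hin N).summable, ?_⟩
    have e : (fun N : ℕ => ∑' n, Sn (ww x y Z) n N * (ww x 0 1 N * t ^ N)) =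
        fun N => SS (ww x y Z) N * (ww x 0 1 N * t ^ N) := funext fun N => (hin N).tsum_eq
    have := summable_outer x y Z t hx hy hZ ht
    rw [← e] at this
    exact this
  exact (Equiv.prodComm ℕ ℕ).summable_iff.mpr h

lemma summable_FF_real (x y Z t : ℝ) (hx : ‖x‖ < 1 / 2) (hy : ‖y‖ < 1 / 4) (hZ : ‖Z‖ < 1 / 8)
    (ht : ‖t‖ < 1 / 2) (hpos : ∀ j, 0 ≤ FF x y Z t j) : Summable (FF x y Z t) := by
  have hfib := hasSum_FF_fiber x y Z t (by linarith)
  refine (summable_sigma_of_nonneg hpos).mpr ⟨fun q => (hfib q).summable, ?_⟩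
  have e : (fun q => ∑' b, FF x y Z t ⟨q, b⟩) =
      fun q : ℕ × ℕ => Sn (ww x y Z) q.1 q.2 * (ww x 0 1 q.2 * t ^ q.2) :=
    funext fun q => (hfib q).tsum_eq
  rw [e]
  exact summable_mid x y Z t hx hy hZ ht fun q => (hfib q).nonneg fun b => hpos _

lemma summable_FF (x y Z t : ℂ) (hx : ‖x‖ < 1 / 2) (hy : ‖y‖ < 1 / 4) (hZ : ‖Z‖ < 1 / 8)
    (ht : ‖t‖ < 1 / 2) : Summable (FF x y Z t) := by
  have hpos : ∀ j, 0 ≤ FF ‖x‖ ‖y‖ ‖Z‖ ‖t‖ j := fun j => by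
    rw [← norm_FF]; exact norm_nonneg _
  have h := summable_FF_real ‖x‖ ‖y‖ ‖Z‖ ‖t‖ (by rwa [norm_norm]) (by rwa [norm_norm])
    (by rwa [norm_norm]) (by rwa [norm_norm]) hpos
  exact Summable.of_norm (h.congr fun j => (norm_FF x y Z t j).symm)

def cc (x y Z : ℂ) (N : ℕ) : ℂ := SS (ww x y Z) N * ww x 0 1 N

lemma hasSum_FF (x y Z t : ℂ) (hx : ‖x‖ < 1 / 2) (hy : ‖y‖ < 1 / 4) (hZ : ‖Z‖ < 1 / 8)
    (ht : ‖t‖ < 1 / 2) : HasSum (FF x y Z t) (∑' N, cc x y Z N * t ^ N) := by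
  have h1 := (summable_FF x y Z t hx hy hZ ht).hasSum
  have h2 := h1.sigma (hasSum_FF_fiber x y Z t (by linarith))
  rw [← (Equiv.prodComm ℕ ℕ).hasSum_iff] at h2
  have h3 : HasSum (fun N => SS (ww x y Z) N * (ww x 0 1 N * t ^ N)) (∑' j, FF x y Z t j) := by
    refine h2.prod_fiberwise (fun N => ?_)
    have := (hasSum_Sn (ww x y Z) N).mul_right (ww x 0 1 N * t ^ N)
    exact this
  have h4 : (fun N => SS (ww x y Z) N * (ww x 0 1 N * t ^ N)) = fun N => cc x y Z N * t ^ N := by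
    ext N; simp [cc, mul_assoc]
  rw [h4] at h3
  have h5 := h3.tsum_eq
  rw [h5]
  exact h1

lemma norm_cc (x y Z : ℂ) (hx : ‖x‖ < 1 / 2) (hy : ‖y‖ < 1 / 4) (hZ : ‖Z‖ < 1 / 8) (N : ℕ) :
    ‖cc x y Z N‖ ≤ 4 * 2 ^ N := by
  have b1 := (SS_bound (ww x y Z) (fun m _ => by
    have := ww_bound x y Z (1/4) (1/8) hx.le hy.le hZ.le m
    linarith) N).1
  have b2 : ‖ww x 0 1 N‖ ≤ 4 := by
    have := ww_bound x 0 1 0 1 hx.le (by simp) (by simp) N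
    linarith
  unfold cc
  rw [norm_mul, mul_comm]
  gcongr

/-! power series -/

def HH (c : ℕ → ℂ) : Prop := ∀ r : ℝ, 0 ≤ r → r < 1 / 2 → Summable fun N => ‖c N‖ * r ^ N

def dd (c : ℕ → ℂ) (N : ℕ) : ℂ := (N + 1) * c (N + 1)

lemma HH_bound (c : ℕ → ℂ) (h : HH c) (r : ℝ) (h0 : 0 ≤ r) (h1 : r < 1 / 2) :
    Summable fun N : ℕ => ((N : ℝ) + 1) * ‖c (N + 1)‖ * r ^ N := by
  obtain ⟨s, hs1, hs2⟩ := exists_between h1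
  have hs0 : 0 < s := lt_of_le_of_lt h0 hs1
  have hq : ‖r / s‖ < 1 := by
    rw [Real.norm_of_nonneg (by positivity), div_lt_one hs0]; exact hs1
  have ht := tendsto_pow_const_mul_const_pow_of_abs_lt_one 1 hq
  have hb : BddAbove (Set.range fun n : ℕ => (n : ℝ) ^ 1 * (r / s) ^ n) := ht.bddAbove_range
  obtain ⟨C, hC⟩ := hb
  have hC' : ∀ n : ℕ, (n : ℝ) * (r / s) ^ n ≤ C := fun n => by
    have := hC ⟨n, rfl⟩
    simpa using this
  have hC0 : 0 ≤ C := by simpa using hC' 0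
  have hS := ((summable_nat_add_iff 1).mpr (h s hs0.le hs2)).mul_left ((C + 1) / s)
  refine Summable.of_nonneg_of_le (fun N => by positivity) (fun N => ?_) hS
  have h2 : ((N : ℝ) + 1) * r ^ N ≤ (C + 1) * s ^ N := by
    have h3 := hC' N
    have h4 : (r / s) ^ N ≤ 1 := pow_le_one₀ (by positivity) (by
      rw [div_le_one hs0]; exact hs1.le)
    have h5 : r ^ N = (r / s) ^ N * s ^ N := by
      rw [div_pow]; field_simp
    rw [h5]
    have : 0 < s ^ N := by positivity
    nlinarith
  calc _ = ‖c (N + 1)‖ * (((N : ℝ) + 1) * r ^ N) := by ring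
    _ ≤ ‖c (N + 1)‖ * ((C + 1) * s ^ N) := by gcongr
    _ = _ := by field_simp; ring

lemma HH_dd (c : ℕ → ℂ) (h : HH c) : HH (dd c) := by
  intro r h0 h1
  convert HH_bound c h r h0 h1 using 2 with N
  rw [dd, norm_mul]
  congr 2
  have : ((N : ℂ) + 1) = ((N + 1 : ℕ) : ℂ) := by push_cast; ring
  rw [this, Complex.norm_natCast]; push_cast; ring

lemma HH_summable (c : ℕ → ℂ) (h : HH c) (t : ℂ) (ht : ‖t‖ < 1 / 2) :
    Summable fun N => c N * t ^ N := by
  apply Summable.of_norm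
  simpa using h ‖t‖ (norm_nonneg _) ht

lemma HH_deriv (c : ℕ → ℂ) (h : HH c) (t : ℂ) (ht : ‖t‖ < 1 / 2) :
    HasDerivAt (fun t => ∑' N, c N * t ^ N) (∑' N, dd c N * t ^ N) t := by
  obtain ⟨s, hs1, hs2⟩ := exists_between ht
  have hs0 : 0 < s := lt_of_le_of_lt (norm_nonneg _) hs1
  have hb := HH_bound c h s hs0.le hs2
  have hb' : Summable (fun N : ℕ => (N : ℝ) * ‖c N‖ * s ^ (N - 1)) := by
    rw [← summable_nat_add_iff 1]
    simpa using hb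
  have hsum0 : Summable (fun N : ℕ => c N * ((N : ℂ) * t ^ (N - 1))) := by
    refine Summable.of_norm_bounded hb' fun N => ?_
    rw [norm_mul, norm_mul, Complex.norm_natCast, norm_pow]
    calc _ = (N : ℝ) * ‖c N‖ * ‖t‖ ^ (N - 1) := by ring
      _ ≤ _ := by gcongr
  have key := hasDerivAt_tsum_of_isPreconnected (g := fun N t => c N * t ^ N)
    (g' := fun N t => c N * ((N : ℂ) * t ^ (N - 1))) (t := Metric.ball (0 : ℂ) s) (y₀ := t) (y := t)
    hb' Metric.isOpen_ball (convex_ball _ _).isPreconnected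
    (fun N w _ => (hasDerivAt_pow N w).const_mul (c N)) (fun N w hw => by
      rw [norm_mul, norm_mul, Complex.norm_natCast, norm_pow]
      have : ‖w‖ ≤ s := by simpa using (Metric.mem_ball.mp hw).le
      calc _ = (N : ℝ) * ‖c N‖ * ‖w‖ ^ (N - 1) := by ring
        _ ≤ _ := by gcongr)
    (by simpa using hs1) (HH_summable c h t ht) (by simpa using hs1)
  convert! key using 1
  rw [hsum0.tsum_eq_zero_add]
  simp only [Nat.cast_zero, zero_mul, mul_zero, zero_add, Nat.add_sub_cancel]
  congr 1
  ext N
  simp only [dd]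
  push_cast
  ring

lemma sub_ne (x : ℂ) (hx : ‖x‖ < 1 / 2) (N : ℕ) : ((N : ℂ) + 1) - x ≠ 0 := by
  intro h
  have h1 : x = ((N + 1 : ℕ) : ℂ) := by push_cast; exact (sub_eq_zero.mp h).symm
  rw [h1, Complex.norm_natCast] at hx
  push_cast at hx
  have : (0 : ℝ) ≤ N := Nat.cast_nonneg N
  linarith

lemma ww_zero_one (x : ℂ) (hx : ‖x‖ < 1 / 2) (N : ℕ) :
    ((N : ℂ) + 1) * (((N : ℂ) + 1) - x) * ww x 0 1 (N + 1) = 2 := by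
  have h1 : ((N : ℂ) + 1) ≠ 0 := by exact_mod_cast Nat.succ_ne_zero N
  have h2 : ((N : ℂ) + 1) - x ≠ 0 := sub_ne x hx N
  simp only [ww]
  push_cast
  field_simp
  ring

lemma cc_zero (x y Z : ℂ) : cc x y Z 0 = 0 := by simp [cc, SS_zero]

lemma cc_eq1 (x y Z : ℂ) (hx : ‖x‖ < 1 / 2) (N : ℕ) :
    ((N : ℂ) + 1) * (((N : ℂ) + 1) - x) * cc x y Z (N + 1) = 2 * SS (ww x y Z) (N + 1) := by
  rw [cc, ← ww_zero_one x hx N]; ring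

lemma cc_eq2 (x y Z : ℂ) (hx : ‖x‖ < 1 / 2) (N : ℕ) :
    2 * (y * ((N : ℂ) + 1) - x * y + Z) * cc x y Z (N + 1) =
      2 * (ww x y Z (N + 1) * SS (ww x y Z) (N + 1)) := by
  have h1 : ((N : ℂ) + 1) ≠ 0 := by exact_mod_cast Nat.succ_ne_zero N
  have h2 : ((N : ℂ) + 1) - x ≠ 0 := sub_ne x hx N
  simp only [cc, ww]
  push_cast
  field_simp
  ring

lemma ode (x y Z : ℂ) (hx : ‖x‖ < 1 / 2) (hH : HH (cc x y Z)) (t : ℂ) (ht : ‖t‖ < 1 / 2) :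
    t * (1 - t ^ 2) * (∑' N, dd (dd (cc x y Z)) N * t ^ N)
      + ((1 - x) * (1 - t ^ 2) - 2 * t * y) * (∑' N, dd (cc x y Z) N * t ^ N)
      + 2 * (x * y - Z) * (∑' N, cc x y Z N * t ^ N) = 2 := by
  set c := cc x y Z with hc
  have s0 := HH_summable c hH t ht
  have s1 := HH_summable _ (HH_dd c hH) t ht
  have s2 := HH_summable _ (HH_dd _ (HH_dd c hH)) t ht
  set f0 := ∑' N, c N * t ^ N
  set f1 := ∑' N, dd c N * t ^ N
  set f2 := ∑' N, dd (dd c) N * t ^ N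
  set S := SS (ww x y Z) with hS
  have h0 : HasSum (fun N => c N * t ^ N) f0 := s0.hasSum
  have h1 : HasSum (fun N => dd c N * t ^ N) f1 := s1.hasSum
  have h2 : HasSum (fun N => dd (dd c) N * t ^ N) f2 := s2.hasSum
  have a2 : HasSum (fun N : ℕ => (N : ℂ) * dd c N * t ^ N) (t * f2) := by
    rw [← hasSum_nat_add_iff' 1]
    convert! h2.mul_left t using 1
    · ext N; simp only [dd]; push_cast; ring
    · simp
  have hE : HasSum (fun N => 2 * S (N + 1) * t ^ N) (t * f2 + (1 - x) * f1) := by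
    convert! a2.add (h1.mul_left (1 - x)) using 1
    ext N
    rw [hS, ← cc_eq1 x y Z hx N]
    simp only [dd, hc]; ring
  have hQ : HasSum (fun N => 2 * (ww x y Z (N + 1) * S (N + 1)) * t ^ (N + 1))
      (2 * t * y * f1 - 2 * (x * y - Z) * f0) := by
    have b0 : HasSum (fun N => c (N + 1) * t ^ (N + 1)) f0 := by
      have := (hasSum_nat_add_iff' 1).mpr h0
      simpa [hc, cc_zero] using this
    convert! (h1.mul_left (2 * t * y)).sub (b0.mul_left (2 * (x * y - Z))) using 1
    ext N
    rw [hS, ← cc_eq2 x y Z hx N]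
    simp only [dd, hc]; ring
  have hE2 := (hasSum_nat_add_iff' 2).mpr hE
  have hQ2 := (hasSum_nat_add_iff' 1).mpr hQ
  have hE3 := hE2.sub (hE.mul_left (t ^ 2))
  have heq : (fun N => 2 * S (N + 2 + 1) * t ^ (N + 2) - t ^ 2 * (2 * S (N + 1) * t ^ N)) =
      fun N => 2 * (ww x y Z (N + 1 + 1) * S (N + 1 + 1)) * t ^ (N + 1 + 1) := by
    ext N
    have : S (N + 2 + 1) = S (N + 1) + ww x y Z (N + 1 + 1) * S (N + 1 + 1) :=
      SS_rec (ww x y Z) (N + 1)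
    rw [this]; ring
  rw [heq] at hE3
  have hu := hE3.unique hQ2
  have e1 : S 1 = 1 := SS_one _
  have e2 : S 2 = ww x y Z 1 := by
    have := SS_rec (ww x y Z) 0
    rw [SS_zero, SS_one] at this
    simpa using this
  simp [Finset.sum_range_succ, e1, e2] at hu
  linear_combination hu

def ht (n : ℕ) (κ : Fin n → ℕ) : ℕ := (Finset.univ.filter fun i => 2 ≤ κ i).card

lemma ht_eq (n : ℕ) (κ : Fin n → ℕ) : ht n κ = ∑ i, if 2 ≤ κ i then 1 else 0 := by
  rw [ht, Finset.card_filter]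

lemma ht_snoc (n : ℕ) (κ : Fin n → ℕ) (k : ℕ) (hk : 2 ≤ k) :
    ht (n + 1) (Fin.snoc κ k : Fin (n + 1) → ℕ) = ht n κ + 1 := by
  rw [ht_eq, ht_eq, Fin.sum_univ_castSucc]
  simp [hk]

lemma ht_le (n : ℕ) (κ : Fin n → ℕ) : ht n κ ≤ n := by
  unfold ht
  exact (Finset.card_le_univ _).trans (by simp)

lemma ht_sum_le (n : ℕ) (κ : Fin n → ℕ) (h : ∀ i, 1 ≤ κ i) : n + ht n κ ≤ ∑ i, κ i := by
  have : ∑ i : Fin n, (1 + if 2 ≤ κ i then 1 else 0) ≤ ∑ i, κ i := by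
    apply Finset.sum_le_sum
    intro i _
    have := h i
    split_ifs <;> omega
  rw [Finset.sum_add_distrib, ← ht_eq] at this
  simpa using this

lemma prod_vv (x y Z : ℂ) (n : ℕ) (κ : Fin n → ℕ) (h : ∀ i, 1 ≤ κ i) :
    ∏ i, vv x y Z (κ i) = x ^ (∑ i, κ i - n - ht n κ) * y ^ (n - ht n κ) * Z ^ ht n κ := by
  have h1 : ∀ i, vv x y Z (κ i) = x ^ (κ i - 1 - if 2 ≤ κ i then 1 else 0) *
      y ^ (1 - if 2 ≤ κ i then 1 else 0) * Z ^ (if 2 ≤ κ i then 1 else 0) := by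
    intro i
    have := h i
    generalize κ i = k at *
    rcases k with _ | _ | k
    · omega
    · simp [vv]
    · simp [vv]
  simp only [h1]
  rw [Finset.prod_mul_distrib, Finset.prod_mul_distrib, Finset.prod_pow_eq_pow_sum,
    Finset.prod_pow_eq_pow_sum, Finset.prod_pow_eq_pow_sum, ← ht_eq]
  have e1 : ∑ i, (κ i - 1 - if 2 ≤ κ i then 1 else 0) = ∑ i, κ i - n - ht n κ := by
    have : ∑ i, ((κ i - 1 - if 2 ≤ κ i then 1 else 0) + (1 + if 2 ≤ κ i then 1 else 0))
        = ∑ i, κ i := by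
      apply Finset.sum_congr rfl
      intro i _
      have := h i
      split_ifs <;> omega
    rw [Finset.sum_add_distrib, Finset.sum_add_distrib (f := fun _ => 1), ← ht_eq] at this
    simp only [Finset.sum_const, Finset.card_univ, Fintype.card_fin, smul_eq_mul, mul_one] at this
    omega
  have e2 : ∑ i, (1 - if 2 ≤ κ i then 1 else 0) = n - ht n κ := by
    have : ∑ i, ((1 - if 2 ≤ κ i then 1 else 0) + (if 2 ≤ κ i then 1 else 0))
        = ∑ i : Fin n, 1 := by
      apply Finset.sum_congr rfl
      intro i _
      split_ifs <;> omega
    rw [Finset.sum_add_distrib, ← ht_eq] at this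
    simp only [Finset.sum_const, Finset.card_univ, Fintype.card_fin, smul_eq_mul, mul_one] at this
    omega
  rw [e1, e2]

def GGf (x y z t : ℂ) (n : ℕ) (κ m : Fin (n + 1) → ℕ) : ℂ :=
  if (∀ i, 1 ≤ κ i) ∧ 2 ≤ κ (Fin.last n) ∧ athCond (n + 1) m then
    2 ^ (n + 1) * (t ^ (m (Fin.last n)) / ∏ i, ((m i : ℂ) ^ κ i)) *
      x ^ (∑ i, κ i - (n + 1) - ht _ κ) * y ^ (n + 1 - ht _ κ) *
      z ^ (2 * (ht _ κ - 1))
  else 0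

def GG (x y z t : ℂ) (j : Σ n : ℕ, (Fin (n + 1) → ℕ) × (Fin (n + 1) → ℕ)) : ℂ :=
  GGf x y z t j.1 j.2.1 j.2.2

def JKequiv : (Σ q : ℕ × ℕ, ((Fin q.1 → ℕ) × (Fin q.1 → ℕ)) × ℕ) ≃
    (Σ n : ℕ, (Fin (n + 1) → ℕ) × (Fin (n + 1) → ℕ)) where
  toFun j := ⟨j.1.1, (Fin.snoc j.2.1.1 j.2.2, Fin.snoc j.2.1.2 j.1.2)⟩
  invFun j := ⟨(j.1, j.2.2 (Fin.last _)), ((Fin.init j.2.1, Fin.init j.2.2), j.2.1 (Fin.last _))⟩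
  left_inv j := by
    obtain ⟨⟨n, N⟩, ⟨⟨(κ : Fin n → ℕ), (m : Fin n → ℕ)⟩, k⟩⟩ := j
    have h1 : (Fin.snoc m N : Fin (n + 1) → ℕ) (Fin.last n) = N := by simp
    have h2 : (Fin.snoc κ k : Fin (n + 1) → ℕ) (Fin.last n) = k := by simp
    have h3 : Fin.init (Fin.snoc m N : Fin (n + 1) → ℕ) = m := by simp
    have h4 : Fin.init (Fin.snoc κ k : Fin (n + 1) → ℕ) = κ := by simp
    simp only [h2, h3, h4]
    rw [h1]
  right_inv j := by
    obtain ⟨n, ⟨κ, m⟩⟩ := j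
    simp only [Fin.snoc_init_self]

lemma GGf_eq (x y z t : ℂ) (n N k : ℕ) (κ m : Fin n → ℕ) :
    GGf x y z t n (Fin.snoc κ k : Fin (n + 1) → ℕ) (Fin.snoc m N : Fin (n + 1) → ℕ) =
      PP x y (z ^ 2) n κ m N * (uu x 0 1 k N * t ^ N) := by
  simp only [GGf, PP, Fin.snoc_last]
  by_cases ha : athCond (n + 1) (Fin.snoc m N : Fin (n + 1) → ℕ)
  swap
  · simp [ha]
  simp only [ha, and_true, if_true]
  by_cases hk : 2 ≤ k
  swap
  · have : uu x 0 1 k N = 0 := by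
      rcases k with _ | _ | k
      · simp [uu, vv]
      · simp [uu, vv]
      · omega
    simp [hk, this]
  by_cases hκ : ∀ i, 1 ≤ κ i
  · have hc : ∀ i, 1 ≤ (Fin.snoc κ k : Fin (n + 1) → ℕ) i := by
      intro i
      induction i using Fin.lastCases with
      | last => simp; omega
      | cast i => simpa using hκ i
    rw [if_pos ⟨hc, hk⟩, ht_snoc n κ k hk, Fin.prod_univ_castSucc, Fin.sum_univ_castSucc]
    simp only [Fin.snoc_castSucc, Fin.snoc_last, uu]
    rw [Finset.prod_div_distrib, Finset.prod_mul_distrib, prod_vv x y (z ^ 2) n κ hκ]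
    have h1 := ht_sum_le n κ hκ
    have h2 : ∑ i, κ i + k - (n + 1) - (ht n κ + 1) = (∑ i, κ i - n - ht n κ) + (k - 2) := by omega
    have h3 : n + 1 - (ht n κ + 1) = n - ht n κ := by omega
    have h4 : vv x 0 1 k = x ^ (k - 2) := by
      obtain ⟨k, rfl⟩ := Nat.exists_eq_add_of_le' hk
      simp [vv]
    rw [h2, h3, h4, Nat.add_sub_cancel, pow_add, pow_mul]
    simp only [Finset.prod_const, Finset.card_univ, Fintype.card_fin]
    rw [pow_succ]
    simp only [div_eq_mul_inv, mul_inv]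
    ring
  · have hc : ¬ ∀ i, 1 ≤ (Fin.snoc κ k : Fin (n + 1) → ℕ) i := by
      intro h
      apply hκ
      intro i
      simpa using h i.castSucc
    rw [if_neg (fun h => hc h.1)]
    push Not at hκ
    obtain ⟨i, hi⟩ := hκ
    have h0 : κ i = 0 := by omega
    have : ∏ i, uu x y (z ^ 2) (κ i) (m i) = 0 := by
      apply Finset.prod_eq_zero (Finset.mem_univ i)
      simp [h0, uu, vv]
    rw [this, zero_mul]

lemma GG_eq (x y z t : ℂ) (j : Σ q : ℕ × ℕ, ((Fin q.1 → ℕ) × (Fin q.1 → ℕ)) × ℕ) :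
    GG x y z t (JKequiv j) = FF x y (z ^ 2) t j :=
  GGf_eq x y z t j.1.1 j.1.2 j.2.2 j.2.1.1 j.2.1.2

def proj (j : Σ n : ℕ, (Fin (n + 1) → ℕ) × (Fin (n + 1) → ℕ)) : ℕ × ℕ × ℕ :=
  (∑ i, j.2.1 i, j.1 + 1, ht _ j.2.1)

def TT (x y z t : ℂ) (k n s : ℕ) (κ m : Fin (n + 1) → ℕ) : ℂ :=
  2 ^ (n + 1) * (if IdxCond0 k (n + 1) s κ then
    (if athCond (n + 1) m then t ^ lastExp m / ∏ i, ((m i : ℂ) ^ κ i) else 0) else 0)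
    * x ^ (k - (n + 1) - s) * y ^ (n + 1 - s) * z ^ (2 * (s - 1))

lemma TT_eq (x y z t : ℂ) (k n s : ℕ) (κ m : Fin (n + 1) → ℕ) :
    (proj ⁻¹' {(k, n + 1, s)}).indicator (GG x y z t) ⟨n, (κ, m)⟩ =
      TT x y z t k n s κ m := by
  have hl : lastExp m = m (Fin.last n) := by
    simp [lastExp]; rfl
  have hI : IdxCond0 k (n + 1) s κ ↔
      ((∀ i, 1 ≤ κ i) ∧ ∑ i, κ i = k ∧ ht (n + 1) κ = s) ∧ 2 ≤ κ (Fin.last n) := by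
    unfold IdxCond0 IdxCond ht
    constructor
    · rintro ⟨h1, h2⟩
      exact ⟨h1, h2 (Nat.succ_pos n)⟩
    · rintro ⟨h1, h2⟩
      exact ⟨h1, fun _ => h2⟩
  unfold TT
  rw [hl]
  simp only [hI]
  by_cases hp : ∑ i, κ i = k ∧ ht (n + 1) κ = s
  · have hmem : (⟨n, (κ, m)⟩ : Σ n : ℕ, (Fin (n + 1) → ℕ) × (Fin (n + 1) → ℕ)) ∈
        proj ⁻¹' {(k, n + 1, s)} := by
      simp [proj, hp.1, hp.2]
    rw [Set.indicator_of_mem hmem]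
    obtain ⟨rfl, rfl⟩ := hp
    simp only [GG, GGf]
    by_cases h1 : ∀ i, 1 ≤ κ i
    · by_cases h2 : 2 ≤ κ (Fin.last n)
      · by_cases h3 : athCond (n + 1) m
        · rw [if_pos ⟨h1, h2, h3⟩, if_pos ⟨⟨h1, by trivial, by trivial⟩, h2⟩, if_pos h3]
        · rw [if_neg (fun h => h3 h.2.2), if_neg h3]; simp
      · rw [if_neg (fun h => h2 h.2.1), if_neg (fun h => h2 h.2)]; simp
    · rw [if_neg (fun h => h1 h.1), if_neg (fun h => h1 h.1.1)]; simp
  · rw [Set.indicator_of_notMem, if_neg (fun h => hp h.1.2)]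
    · simp
    · intro h
      apply hp
      simpa [proj] using h

lemma Phi0Term_TT (x y z t : ℂ) (k n s : ℕ) :
    Phi0Term x y z (k, n + 1, s) t = ∑' κ, ∑' m, TT x y z t k n s κ m := by
  have h1 : ∑' κ, ∑' m, TT x y z t k n s κ m = G0 k (n + 1) s t * x ^ (k - (n + 1) - s) *
      y ^ (n + 1 - s) * z ^ (2 * (s - 1)) := by
    unfold G0 Ath TT
    simp only [tsum_mul_right, tsum_mul_left]
    congr 5
    ext κ
    split_ifs with h
    · rfl
    · simp
  rw [h1]
  unfold Phi0Term
  simp only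
  split_ifs with hc
  · rfl
  · have h2 : G0 k (n + 1) s t = 0 := by
      unfold G0
      have : ∀ κ : Fin (n + 1) → ℕ, ¬ IdxCond0 k (n + 1) s κ := by
        rintro κ ⟨⟨h1, h2, h3⟩, h4⟩
        have h4 := h4 (Nat.succ_pos n)
        apply hc
        refine ⟨?_, by omega, ?_⟩
        · rw [← h2]
          exact (h1 (Fin.last n)).trans
            (Finset.single_le_sum (f := κ) (fun i _ => Nat.zero_le _) (Finset.mem_univ _))
        · rw [← h3]
          exact Finset.card_pos.mpr ⟨_, Finset.mem_filter.mpr ⟨Finset.mem_univ _, h4⟩⟩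
      simp [this]
    simp [h2]

lemma Phi0_eq (x y z t : ℂ) (hx : ‖x‖ < 1 / 2) (hy : ‖y‖ < 1 / 4) (hZ : ‖z ^ 2‖ < 1 / 8)
    (ht : ‖t‖ < 1 / 2) : Phi0 x y z t = ∑' N, cc x y (z ^ 2) N * t ^ N := by
  have hG : HasSum (GG x y z t) (∑' N, cc x y (z ^ 2) N * t ^ N) := by
    rw [← JKequiv.hasSum_iff]
    have : GG x y z t ∘ JKequiv = FF x y (z ^ 2) t := funext fun j => GG_eq x y z t j
    rw [this]
    exact hasSum_FF x y (z ^ 2) t hx hy hZ ht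
  have hF := (hG.tsum_fiberwise proj).tsum_eq
  rw [← hF]
  unfold Phi0
  apply tsum_congr
  rintro ⟨k, n, s⟩
  rw [tsum_subtype (proj ⁻¹' {(k, n, s)}) (GG x y z t)]
  rcases n with _ | n
  · have h0 : ∀ j, (proj ⁻¹' {(k, 0, s)}).indicator (GG x y z t) j = 0 := by
      intro j
      apply Set.indicator_of_notMem
      simp [proj]
    simp [h0, Phi0Term]
  · rw [Phi0Term_TT]
    have hs : Summable ((proj ⁻¹' {(k, n + 1, s)}).indicator (GG x y z t)) :=
      hG.summable.indicator _
    have hinj : Function.Injective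
        (Sigma.mk n : _ → Σ n : ℕ, (Fin (n + 1) → ℕ) × (Fin (n + 1) → ℕ)) := sigma_mk_injective
    have hsupp : Function.support ((proj ⁻¹' {(k, n + 1, s)}).indicator (GG x y z t)) ⊆
        Set.range (Sigma.mk n : _ → Σ n : ℕ, (Fin (n + 1) → ℕ) × (Fin (n + 1) → ℕ)) := by
      rintro ⟨n', b⟩ hj
      have := Set.mem_of_indicator_ne_zero hj
      have h1 : n' = n := by
        simp [proj] at this
        exact this.2.1
      subst h1
      exact ⟨b, rfl⟩
    rw [← hinj.tsum_eq hsupp]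
    have hs2 : Summable (fun b : (Fin (n + 1) → ℕ) × (Fin (n + 1) → ℕ) =>
        TT x y z t k n s b.1 b.2) := by
      have := hs.comp_injective hinj
      refine this.congr ?_
      rintro ⟨κ, m⟩
      simp only [Function.comp]
      exact TT_eq x y z t k n s κ m
    rw [← hs2.tsum_prod (f := fun b => TT x y z t k n s b.1 b.2)]
    apply tsum_congr
    rintro ⟨κ, m⟩
    exact (TT_eq x y z t k n s κ m).symm

lemma HH_cc (x y Z : ℂ) (hx : ‖x‖ < 1 / 2) (hy : ‖y‖ < 1 / 4) (hZ : ‖Z‖ < 1 / 8) :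
    HH (cc x y Z) := by
  intro r h0 h1
  have hg : Summable (fun N : ℕ => 4 * (2 * r) ^ N) :=
    (summable_geometric_of_lt_one (by positivity) (by linarith)).mul_left 4
  refine Summable.of_nonneg_of_le (fun N => by positivity) (fun N => ?_) hg
  calc _ ≤ (4 * 2 ^ N) * r ^ N := by
        gcongr
        exact norm_cc x y Z hx hy hZ N
    _ = _ := by ring

/-- The inhomogeneous Heun-type equation satisfied by `Φ₀`: for `0 < |t| < 1/2`,
`t(1−t²)Φ₀″ + ((1−x)(1−t²) − 2ty)Φ₀′ + 2(xy − z²)Φ₀ = 2`. -/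
theorem Phi0_heun_equation (x y z : ℂ) (hx : ‖x‖ < 1 / 2) (hy : ‖y‖ < 1 / 4)
    (hx0 : x ≠ 0) (hy0 : y ≠ 0) (hz : ‖z ^ 2‖ < ‖x * y‖)
    (t : ℂ) (ht0 : 0 < ‖t‖) (ht : ‖t‖ < 1 / 2) :
    t * (1 - t ^ 2) * deriv (deriv (fun t => Phi0 x y z t)) t
      + ((1 - x) * (1 - t ^ 2) - 2 * t * y) * deriv (fun t => Phi0 x y z t) t
      + 2 * (x * y - z ^ 2) * Phi0 x y z t = 2 := by
  have hZ : ‖z ^ 2‖ < 1 / 8 := by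
    have h1 : ‖x * y‖ ≤ 1 / 2 * (1 / 4) := by
      rw [norm_mul]
      gcongr
    linarith
  have hH := HH_cc x y (z ^ 2) hx hy hZ
  have hball : ∀ s : ℂ, ‖s‖ < 1 / 2 → ∀ᶠ w in nhds s, ‖w‖ < 1 / 2 := fun s hs =>
    continuous_norm.continuousAt.eventually_lt continuousAt_const hs
  have d1 : ∀ s : ℂ, ‖s‖ < 1 / 2 →
      deriv (fun t => Phi0 x y z t) s = ∑' N, dd (cc x y (z ^ 2)) N * s ^ N := by
    intro s hs
    have he : (fun t => Phi0 x y z t) =ᶠ[nhds s] fun t => ∑' N, cc x y (z ^ 2) N * t ^ N :=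
      (hball s hs).mono fun w hw => Phi0_eq x y z w hx hy hZ hw
    rw [he.deriv_eq]
    exact (HH_deriv _ hH s hs).deriv
  have d2 : deriv (deriv (fun t => Phi0 x y z t)) t =
      ∑' N, dd (dd (cc x y (z ^ 2))) N * t ^ N := by
    have he : deriv (fun t => Phi0 x y z t) =ᶠ[nhds t]
        fun t => ∑' N, dd (cc x y (z ^ 2)) N * t ^ N :=
      (hball t ht).mono fun w hw => d1 w hw
    rw [he.deriv_eq]
    exact (HH_deriv _ (HH_dd _ hH) t ht).deriv
  rw [d2, d1 t ht, Phi0_eq x y z t hx hy hZ ht]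
  exact ode x y (z ^ 2) hx hH t ht

end
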